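/- Let v_t : ℝ^d → ℝ^d be C² in both t and x and globally Lipschitz in x, and let ρ_t be an everywhere-positive C¹-in-t, C²-in-x solution of the transport equation ∂_t ρ_t(x) = −∇·(v_t(x) ρ_t(x)) with ρ_0 a probability density. Let X_{0,t}(x) denote the flow of v: (d/dt) X_{0,t}(x) = v_t(X_{0,t}(x)) with X_{0,0}(x) = x, and assume X_{0,t} : ℝ^d → ℝ^d is a C¹ diffeomorphism for each t. Then for every bounded continuous test function φ : ℝ^d → ℝ and every t ≥ 0, ∫_{ℝ^d} φ(y) ρ_t(y) dy = ∫_{ℝ^d} φ(X_{0,t}(x)) ρ_0(x) dx; that is, ρ_t is the pushforward of ρ_0 under X_{0,t}. -/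

import Mathlib

open MeasureTheory Matrix Filter
open scoped Topology

noncomputable section

/-- The divergence of a vector field on `Fin d → ℝ`. -/
def dvg {d : ℕ} (F : (Fin d → ℝ) → (Fin d → ℝ)) (x : Fin d → ℝ) : ℝ :=
  ∑ i, fderiv ℝ F x (Pi.single i 1) i

section Flow

variable {E : Type*} [NormedAddCommGroup E] [NormedSpace ℝ E]

/-- Grönwall's inequality for two trajectories, forward and backward in time. -/
theorem dist_le_of_hasDerivAt_trajectories {v : ℝ → E → E} {K : NNReal}
    (hv : ∀ t, LipschitzWith K (v t)) {f g : ℝ → E}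
    (hf : ∀ t, HasDerivAt f (v t (f t)) t) (hg : ∀ t, HasDerivAt g (v t (g t)) t) (a b : ℝ) :
    dist (f b) (g b) ≤ dist (f a) (g a) * Real.exp (K * |b - a|) := by
  rcases le_total a b with hab | hab
  · rw [abs_of_nonneg (sub_nonneg.2 hab)]
    exact dist_le_of_trajectories_ODE hv
      (fun t _ => (hf t).continuousAt.continuousWithinAt) (fun t _ => (hf t).hasDerivWithinAt)
      (fun t _ => (hg t).continuousAt.continuousWithinAt) (fun t _ => (hg t).hasDerivWithinAt)
      le_rfl b ⟨hab, le_rfl⟩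
  · have hrev : ∀ {h : ℝ → E}, (∀ t, HasDerivAt h (v t (h t)) t) →
        ∀ t, HasDerivAt (fun s => h (-s)) (-v (-t) (h (-t))) t := fun {h} hh t => by
      simpa [Function.comp_def] using (hh (-t)).scomp t (hasDerivAt_neg t)
    have key := dist_le_of_trajectories_ODE (v := fun t y => -v (-t) y) (K := K)
      (f := fun s => f (-s)) (g := fun s => g (-s)) (a := -a) (b := -b) (fun t => (hv (-t)).neg)
      (fun t _ => (hrev hf t).continuousAt.continuousWithinAt)
      (fun t _ => (hrev hf t).hasDerivWithinAt)
      (fun t _ => (hrev hg t).continuousAt.continuousWithinAt)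
      (fun t _ => (hrev hg t).hasDerivWithinAt)
      le_rfl (-b) ⟨by linarith, le_rfl⟩
    rw [abs_of_nonpos (sub_nonpos.2 hab)]
    simp only [neg_neg] at key
    convert key using 3
    ring

/-- A flow of a globally Lipschitz field is jointly continuous. -/
theorem continuous_uncurry_flow {v X : ℝ → E → E} {K : NNReal}
    (hv : ∀ t, LipschitzWith K (v t)) (hX0 : ∀ x, X 0 x = x)
    (hX : ∀ t x, HasDerivAt (fun τ => X τ x) (v t (X t x)) t) :
    Continuous (Function.uncurry X) := by
  rw [continuous_iff_continuousAt]
  rintro ⟨t, x⟩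
  rw [ContinuousAt, tendsto_iff_dist_tendsto_zero]
  have hb : ∀ p : ℝ × E, dist (X p.1 p.2) (X t x) ≤
      dist p.2 x * Real.exp (K * |p.1|) + dist (X p.1 x) (X t x) := fun p => by
    refine (dist_triangle _ (X p.1 x) _).trans (add_le_add_left ?_ _)
    simpa [hX0] using dist_le_of_hasDerivAt_trajectories hv
      (f := fun τ => X τ p.2) (g := fun τ => X τ x) (fun s => hX s _) (fun s => hX s _) 0 p.1
  refine squeeze_zero (fun _ => dist_nonneg) hb ?_
  have hXx : Continuous fun s => X s x :=
    continuous_iff_continuousAt.2 fun s => (hX s x).continuousAt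
  have hc : Continuous fun p : ℝ × E =>
      dist p.2 x * Real.exp (K * |p.1|) + dist (X p.1 x) (X t x) := by fun_prop
  simpa using hc.tendsto (t, x)

/-- Starting points `x'` with `X s x' = X a x` converge to `x` as `s → a`. -/
theorem tendsto_flow_preimage {v X : ℝ → E → E} {K : NNReal}
    (hv : ∀ t, LipschitzWith K (v t)) (hX0 : ∀ x, X 0 x = x)
    (hX : ∀ t x, HasDerivAt (fun τ => X τ x) (v t (X t x)) t) {a : ℝ} {x : E} {w : ℝ → E}
    (hw : ∀ s, X s (w s) = X a x) : Tendsto w (𝓝 a) (𝓝 x) := by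
  rw [tendsto_iff_dist_tendsto_zero]
  have hb : ∀ s, dist (w s) x ≤ dist (X a x) (X s x) * Real.exp (K * |s|) := fun s => by
    simpa [hX0, hw] using dist_le_of_hasDerivAt_trajectories hv
      (f := fun τ => X τ (w s)) (g := fun τ => X τ x) (fun s => hX s _) (fun s => hX s _) s 0
  refine squeeze_zero (fun _ => dist_nonneg) hb ?_
  have hXx : Continuous fun s => X s x :=
    continuous_iff_continuousAt.2 fun s => (hX s x).continuousAt
  have hc : Continuous fun s => dist (X a x) (X s x) * Real.exp (K * |s|) := by fun_prop
  simpa using hc.tendsto a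

theorem eq_of_hasDerivAt_zero_uIcc {h : ℝ → ℝ} {a b : ℝ}
    (hd : ∀ s ∈ Set.uIcc a b, HasDerivAt h 0 s) : h a = h b := by
  have := (convex_uIcc a b).norm_image_sub_le_of_norm_hasDerivWithin_le (C := 0)
    (fun s hs => (hd s hs).hasDerivWithinAt) (by simp) Set.right_mem_uIcc Set.left_mem_uIcc
  simpa [sub_eq_zero] using this

end Flow

section Taylor

variable {E : Type*} [NormedAddCommGroup E] [NormedSpace ℝ E]

/-- A derivative-free `C^{1,1}` bound with constant `n` on the closed ball of radius `R`. It is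
stable under pointwise limits. -/
def TaylorBoundOn (f : E → ℝ) (n R : ℝ) : Prop :=
  ∀ y ∈ Metric.closedBall (0 : E) R, ∀ z ∈ Metric.closedBall (0 : E) R,
    |f z - f y| ≤ n * ‖z - y‖ ∧
    ∀ s ∈ Set.Icc (0 : ℝ) 1, |f (y + s • (z - y)) - f y - s * (f z - f y)| ≤ s * n * ‖z - y‖ ^ 2

theorem isClosed_setOf_taylorBoundOn {L : ℝ → E → ℝ} (hL : ∀ y, Continuous fun t => L t y)
    (n R : ℝ) : IsClosed {t | TaylorBoundOn (L t) n R} := by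
  simp only [TaylorBoundOn, Set.ofPred_forall, Set.ofPred_and]
  refine isClosed_iInter fun y => isClosed_iInter fun _ => isClosed_iInter fun z =>
    isClosed_iInter fun _ => IsClosed.inter ?_ ?_
  · exact isClosed_le (by fun_prop) continuous_const
  · refine isClosed_iInter fun s => isClosed_iInter fun _ => ?_
    exact isClosed_le (by fun_prop) continuous_const

theorem exists_taylorBoundOn [ProperSpace E] {f : E → ℝ} (hf : ContDiff ℝ 2 f) (R : ℝ) :
    ∃ n : ℕ, TaylorBoundOn f n R := by
  have hd : Differentiable ℝ f := hf.differentiable (by norm_num)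
  have hf1 : ContDiff ℝ 1 (fderiv ℝ f) := hf.fderiv_right (by norm_num)
  have hd2 : Differentiable ℝ (fderiv ℝ f) := hf1.differentiable (by norm_num)
  have hK : IsCompact (Metric.closedBall (0 : E) R) := isCompact_closedBall 0 R
  have hconv : Convex ℝ (Metric.closedBall (0 : E) R) := convex_closedBall 0 R
  obtain ⟨M₁, hM₁⟩ := hK.exists_bound_of_continuousOn hf1.continuous.continuousOn
  obtain ⟨M₂, hM₂⟩ := hK.exists_bound_of_continuousOn
    (hf1.continuous_fderiv (by norm_num)).continuousOn
  obtain ⟨n, hn⟩ := exists_nat_ge (max M₁ (2 * M₂))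
  have hn₁ : M₁ ≤ n := (le_max_left _ _).trans hn
  have hn₂ : 2 * M₂ ≤ n := (le_max_right _ _).trans hn
  have taylor : ∀ y ∈ Metric.closedBall (0 : E) R, ∀ z ∈ Metric.closedBall (0 : E) R,
      |f z - f y - fderiv ℝ f y (z - y)| ≤ M₂ * ‖z - y‖ ^ 2 := fun y hy z hz => by
    have hM₂0 : 0 ≤ M₂ := (norm_nonneg _).trans (hM₂ y hy)
    have hseg : segment ℝ y z ⊆ Metric.closedBall (0 : E) R := hconv.segment_subset hy hz
    have := (convex_segment y z).norm_image_sub_le_of_norm_hasFDerivWithin_le'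
      (f := f) (f' := fderiv ℝ f) (φ := fderiv ℝ f y) (C := M₂ * ‖z - y‖)
      (fun w _ => (hd w).hasFDerivAt.hasFDerivWithinAt)
      (fun w hw => by
        refine (hconv.norm_image_sub_le_of_norm_hasFDerivWithin_le
          (fun u _ => (hd2 u).hasFDerivAt.hasFDerivWithinAt) hM₂ hy (hseg hw)).trans ?_
        gcongr
        rw [segment_eq_image'] at hw
        obtain ⟨θ, hθ, rfl⟩ := hw
        simp only [add_sub_cancel_left, norm_smul, Real.norm_eq_abs, abs_of_nonneg hθ.1]
        exact mul_le_of_le_one_left (norm_nonneg _) hθ.2)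
      (left_mem_segment ℝ y z) (right_mem_segment ℝ y z)
    rw [Real.norm_eq_abs] at this
    linarith
  refine ⟨n, fun y hy z hz => ⟨?_, fun s hs => ?_⟩⟩
  · refine (hconv.norm_image_sub_le_of_norm_hasFDerivWithin_le
      (fun u _ => (hd u).hasFDerivAt.hasFDerivWithinAt) hM₁ hy hz).trans ?_
    gcongr
  · have hM₂0 : 0 ≤ M₂ := (norm_nonneg _).trans (hM₂ y hy)
    have hw : y + s • (z - y) ∈ Metric.closedBall (0 : E) R :=
      hconv.add_smul_sub_mem hy hz hs
    have h₁ := abs_le.1 (taylor y hy z hz)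
    have h₂ := taylor y hy _ hw
    simp only [add_sub_cancel_left, map_smul, norm_smul, Real.norm_eq_abs, abs_of_nonneg hs.1,
      smul_eq_mul] at h₂
    have h₂ := abs_le.1 h₂
    have hN := sq_nonneg ‖z - y‖
    have hs2 : M₂ * (s * ‖z - y‖) ^ 2 ≤ s * (M₂ * ‖z - y‖ ^ 2) := by
      have : s * (M₂ * ‖z - y‖ ^ 2) - M₂ * (s * ‖z - y‖) ^ 2
          = s * (1 - s) * (M₂ * ‖z - y‖ ^ 2) := by ring
      have h0 : 0 ≤ s * (1 - s) * (M₂ * ‖z - y‖ ^ 2) :=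
        mul_nonneg (mul_nonneg hs.1 (by linarith [hs.2])) (mul_nonneg hM₂0 hN)
      linarith
    have hsn : s * (2 * M₂ * ‖z - y‖ ^ 2) ≤ s * n * ‖z - y‖ ^ 2 := by
      have := mul_le_mul_of_nonneg_left (mul_le_mul_of_nonneg_right hn₂ hN) hs.1
      linarith
    have h₃ := mul_le_mul_of_nonneg_left h₁.1 hs.1
    have h₄ := mul_le_mul_of_nonneg_left h₁.2 hs.1
    rw [abs_le]
    constructor <;> linarith

theorem TaylorBoundOn.norm_fderiv_le {f : E → ℝ} {n R : ℝ} (h : TaylorBoundOn f n R) (hn : 0 ≤ n)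
    {y : E} (hy : ‖y‖ < R) (hf : DifferentiableAt ℝ f y) : ‖fderiv ℝ f y‖ ≤ n := by
  refine hf.hasFDerivAt.le_of_lip' hn ?_
  have : Metric.ball (0 : E) R ∈ 𝓝 y := Metric.isOpen_ball.mem_nhds (by simpa using hy)
  filter_upwards [this] with z hz
  exact (h y (by simpa using hy.le) z (Metric.ball_subset_closedBall hz)).1

theorem TaylorBoundOn.abs_sub_fderiv_le {f : E → ℝ} {n R : ℝ} (h : TaylorBoundOn f n R)
    {y z : E} (hy : y ∈ Metric.closedBall (0 : E) R) (hz : z ∈ Metric.closedBall (0 : E) R)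
    (hf : DifferentiableAt ℝ f y) :
    |f z - f y - fderiv ℝ f y (z - y)| ≤ n * ‖z - y‖ ^ 2 := by
  have hline : HasDerivAt (fun s : ℝ => f (y + s • (z - y))) (fderiv ℝ f y (z - y)) 0 := by
    simpa [HasLineDerivAt] using hf.hasFDerivAt.hasLineDerivAt (z - y)
  have hlim := (hline.tendsto_slope_zero_right)
  simp only [zero_add, zero_smul, add_zero, smul_eq_mul] at hlim
  have hlim2 := ((hlim.sub_const (f z - f y)).abs)
  rw [abs_sub_comm]
  refine le_of_tendsto hlim2 ?_
  filter_upwards [Ioc_mem_nhdsGT (zero_lt_one' ℝ)] with s hs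
  have hb := (h y hy z hz).2 s ⟨hs.1.le, hs.2⟩
  have hs0 := hs.1
  have e : s⁻¹ * (f (y + s • (z - y)) - f y) - (f z - f y)
      = s⁻¹ * (f (y + s • (z - y)) - f y - s * (f z - f y)) := by
    field_simp
  rw [e, abs_mul, abs_of_pos (inv_pos.2 hs0), inv_mul_le_iff₀ hs0]
  linarith

/-- Chain rule along a curve, relative to a set of times on which the functions `L t` satisfy a
uniform `C^{1,1}` bound; only separate differentiability of `L` is required. -/
theorem hasDerivWithinAt_comp_of_taylorBoundOn {L : ℝ → E → ℝ} {V : ℝ → E} {γ : ℝ → E}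
    {F : Set ℝ} {t n R l : ℝ} (hn : 0 ≤ n) (hT : ∀ᶠ s in 𝓝[F] t, TaylorBoundOn (L s) n R)
    (hγ : HasDerivAt γ (V t) t) (hR : ‖γ t‖ < R) (hd : ∀ s, Differentiable ℝ (L s))
    (hLt : HasDerivAt (fun s => L s (γ t)) l t) (hV : ContinuousAt V t)
    (hq : ContinuousAt (fun s => fderiv ℝ (L s) (γ t) (V s)) t) :
    HasDerivWithinAt (fun s => L s (γ s)) (l + fderiv ℝ (L t) (γ t) (V t)) F t := by
  set y := γ t with hy
  have hid : Tendsto (fun s => s - t) (𝓝[F] t) (𝓝 0) := by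
    have : Tendsto (fun s : ℝ => s - t) (𝓝 t) (𝓝 (t - t)) := by
      exact (continuous_id.sub continuous_const).tendsto t
    rw [sub_self] at this
    exact this.mono_left nhdsWithin_le_nhds
  have hγO : (fun s => γ s - y) =O[𝓝[F] t] fun s => s - t :=
    hγ.hasDerivWithinAt.hasFDerivWithinAt.isBigO_sub
  have hball : ∀ᶠ s in 𝓝[F] t, γ s ∈ Metric.closedBall (0 : E) R := by
    have : ∀ᶠ s in 𝓝 t, ‖γ s‖ < R := hγ.continuousAt.norm.eventually_lt continuousAt_const hR
    filter_upwards [this.filter_mono nhdsWithin_le_nhds] with s hs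
    simpa using hs.le
  have h₁ : (fun s => L s (γ s) - L s y - fderiv ℝ (L s) y (γ s - y)) =o[𝓝[F] t]
      fun s => s - t := by
    have hO : (fun s => L s (γ s) - L s y - fderiv ℝ (L s) y (γ s - y)) =O[𝓝[F] t]
        fun s => ‖γ s - y‖ ^ 2 := by
      refine Asymptotics.IsBigO.of_bound n ?_
      filter_upwards [hT, hball] with s hs hsb
      simpa using hs.abs_sub_fderiv_le (by simpa using hR.le) hsb (hd s y)
    refine hO.trans_isLittleO ((hγO.norm_left.pow 2).trans_isLittleO ?_)
    have : (fun s => (s - t) * (s - t)) =o[𝓝[F] t] fun s => 1 * (s - t) :=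
      ((Asymptotics.isLittleO_one_iff ℝ).2 hid).mul_isBigO (Asymptotics.isBigO_refl _ _)
    simpa [sq] using this
  have h₂ : (fun s => fderiv ℝ (L s) y (γ s - y - (s - t) • V s)) =o[𝓝[F] t]
      fun s => s - t := by
    have hO : (fun s => fderiv ℝ (L s) y (γ s - y - (s - t) • V s)) =O[𝓝[F] t]
        fun s => γ s - y - (s - t) • V s := by
      refine Asymptotics.IsBigO.of_bound n ?_
      filter_upwards [hT] with s hs
      exact (fderiv ℝ (L s) y).le_of_opNorm_le (hs.norm_fderiv_le hn hR (hd s y)) _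
    refine hO.trans_isLittleO ?_
    have ha := hasDerivWithinAt_iff_isLittleO.1 (hγ.hasDerivWithinAt (s := F))
    have hb : (fun s => (s - t) • (V s - V t)) =o[𝓝[F] t] fun s => (s - t) • (1 : ℝ) := by
      refine (Asymptotics.isBigO_refl _ _).smul_isLittleO ((Asymptotics.isLittleO_one_iff ℝ).2 ?_)
      have := hV.tendsto.sub_const (V t)
      rw [sub_self] at this
      exact this.mono_left nhdsWithin_le_nhds
    simp only [smul_eq_mul, mul_one] at hb
    refine (ha.sub hb).congr_left fun s => ?_
    rw [smul_sub]
    abel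
  have h₃ : (fun s => (s - t) * (fderiv ℝ (L s) y (V s) - fderiv ℝ (L t) y (V t))) =o[𝓝[F] t]
      fun s => s - t := by
    have : (fun s => (s - t) * (fderiv ℝ (L s) y (V s) - fderiv ℝ (L t) y (V t))) =o[𝓝[F] t]
        fun s => (s - t) * (1 : ℝ) := by
      refine (Asymptotics.isBigO_refl _ _).mul_isLittleO ((Asymptotics.isLittleO_one_iff ℝ).2 ?_)
      have := hq.tendsto.sub_const (fderiv ℝ (L t) y (V t))
      rw [sub_self] at this
      exact this.mono_left nhdsWithin_le_nhds
    simpa using this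
  have h₄ := hasDerivWithinAt_iff_isLittleO.1 (hLt.hasDerivWithinAt (s := F))
  rw [hasDerivWithinAt_iff_isLittleO]
  refine (((h₁.add h₂).add h₃).add h₄).congr_left fun s => ?_
  simp only [map_sub, map_smul, smul_eq_mul, ← hy]
  ring

end Taylor

section Transport

variable {E : Type*} [NormedAddCommGroup E] [NormedSpace ℝ E]

/-- If `L t (X t x)` plus the time integral of a jointly continuous `C` is constant in time on a
half-open interval for all `x` in an open set, then it is also constant up to the missing endpoint,
although `L` is only separately continuous. -/
theorem eq_at_endpoint_of_hasDerivAt_zero {v X : ℝ → E → E} {K : NNReal}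
    (hv : ∀ t, LipschitzWith K (v t)) (hX0 : ∀ x, X 0 x = x)
    (hX : ∀ t x, HasDerivAt (fun τ => X τ x) (v t (X t x)) t)
    (hXs : ∀ t, Function.Surjective (X t)) {L C : ℝ → E → ℝ}
    (hC : Continuous (Function.uncurry C)) (hLx : ∀ t, Continuous (L t))
    (hLt : ∀ y, Continuous fun t => L t y) {U : Set E} (hU : IsOpen U) {a b : ℝ}
    (hab : ∀ s ∈ Set.uIcc a b, s ≠ a → ∀ x ∈ U,
      HasDerivAt (fun τ => L τ (X τ x) + C τ x) 0 s) {x : E} (hx : x ∈ U) :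
    L a (X a x) + C a x = L b (X b x) + C b x := by
  rcases eq_or_ne a b with rfl | hne
  · rfl
  set S : Set ℝ := Set.uIcc a b \ {a} with hS
  have hconst : ∀ s ∈ S, ∀ z ∈ U, L s (X s z) + C s z = L b (X b z) + C b z := fun s hs z hz => by
    refine eq_of_hasDerivAt_zero_uIcc (h := fun τ => L τ (X τ z) + C τ z) fun τ hτ => ?_
    have hsa : s ≠ a := hs.2
    have hsub := Set.uIcc_subset_uIcc hs.1 Set.right_mem_uIcc hτ
    refine hab τ hsub ?_ z hz
    rintro rfl
    refine hsa ?_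
    have hs1 := hs.1
    rw [Set.mem_uIcc] at hτ hs1
    rcases hτ with h | h <;> rcases hs1 with h' | h' <;>
      exact le_antisymm (by linarith) (by linarith)
  have : (𝓝[S] a).NeBot := by
    rw [← mem_closure_iff_nhdsWithin_neBot]
    have hsub : Set.uIoo a b ⊆ S := fun s hs =>
      ⟨Set.uIoo_subset_uIcc_self hs, by
        rintro rfl
        simp [Set.uIoo] at hs
        grind⟩
    refine closure_mono hsub ?_
    rw [Set.uIoo, closure_Ioo (by simpa using hne)]
    exact Set.left_mem_uIcc
  choose w hw using fun s => hXs s (X a x)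
  have hwlim : Tendsto w (𝓝[S] a) (𝓝 x) :=
    (tendsto_flow_preimage hv hX0 hX hw).mono_left nhdsWithin_le_nhds
  have hid : Tendsto (fun s : ℝ => s) (𝓝[S] a) (𝓝 a) := nhdsWithin_le_nhds
  have hXb : Continuous (X b) :=
    (continuous_uncurry_flow hv hX0 hX).comp (Continuous.prodMk_right b)
  have hCb : Continuous (C b) := hC.comp (Continuous.prodMk_right b)
  have hlim₁ : Tendsto (fun s => L s (X a x) + C s (w s)) (𝓝[S] a) (𝓝 (L a (X a x) + C a x)) :=
    (((hLt _).tendsto a).mono_left nhdsWithin_le_nhds).add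
      ((hC.tendsto (a, x)).comp (hid.prodMk_nhds hwlim))
  have hlim₂ : Tendsto (fun s => L b (X b (w s)) + C b (w s)) (𝓝[S] a)
      (𝓝 (L b (X b x) + C b x)) :=
    ((((hLx b).comp hXb).add hCb).tendsto x).comp hwlim
  refine tendsto_nhds_unique (hlim₁.congr' ?_) hlim₂
  filter_upwards [self_mem_nhdsWithin, hwlim.eventually_mem (hU.mem_nhds hx)] with s hs hws
  rw [← hconst s hs _ hws, hw]

/-- Method of characteristics for a function `L` that is only separately differentiable in time
and space. The set of bad times is shown to be empty by Baire's theorem. -/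
theorem add_integral_along_flow_eq [ProperSpace E] {v X : ℝ → E → E} {K : NNReal}
    (hv : ∀ t, LipschitzWith K (v t)) (hvt : ∀ y, Continuous fun t => v t y)
    (hX0 : ∀ x, X 0 x = x)
    (hX : ∀ t x, HasDerivAt (fun τ => X τ x) (v t (X t x)) t)
    (hXs : ∀ t, Function.Surjective (X t)) {L c : ℝ → E → ℝ}
    (hc : Continuous (Function.uncurry c)) (hLx : ∀ t, ContDiff ℝ 2 (L t))
    (hLt : ∀ t y, HasDerivAt (fun τ => L τ y) (-(fderiv ℝ (L t) y (v t y) + c t y)) t)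
    (hq : ∀ y, Continuous fun t => fderiv ℝ (L t) y (v t y)) (t : ℝ) (x : E) :
    L t (X t x) + ∫ τ in (0 : ℝ)..t, c τ (X τ x) = L 0 x := by
  have hXc := continuous_uncurry_flow hv hX0 hX
  have hXt : ∀ z, Continuous fun τ => X τ z := fun z =>
    hXc.comp (Continuous.prodMk_left z)
  set C : ℝ → E → ℝ := fun s z => ∫ τ in (0 : ℝ)..s, c τ (X τ z) with hCdef
  have hcX : ∀ z, Continuous fun τ => c τ (X τ z) := fun z =>
    hc.comp (continuous_id.prodMk (hXt z))
  have hC : Continuous (Function.uncurry C) := by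
    have : Continuous (Function.uncurry fun (p : ℝ × E) (τ : ℝ) => c τ (X τ p.2)) :=
      hc.comp (continuous_snd.prodMk (hXc.comp (continuous_snd.prodMk
        (continuous_snd.comp continuous_fst))))
    exact intervalIntegral.continuous_parametric_intervalIntegral_of_continuous this continuous_fst
  have hCd : ∀ s z, HasDerivAt (fun τ => C τ z) (c s (X s z)) s := fun s z =>
    intervalIntegral.integral_hasDerivAt_right ((hcX z).intervalIntegrable _ _)
      ((hcX z).stronglyMeasurableAtFilter _ _) (hcX z).continuousAt
  have hLtc : ∀ y, Continuous fun s => L s y := fun y =>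
    continuous_iff_continuousAt.2 fun s => (hLt s y).continuousAt
  set r : ℝ := ‖x‖ + 1 with hr
  set U : Set E := Metric.ball 0 r with hUdef
  set H : ℝ → E → ℝ := fun s z => L s (X s z) + C s z with hH
  set G : Set ℝ := {s | ∀ᶠ s' in 𝓝 s, ∀ z ∈ U, HasDerivAt (fun τ => H τ z) 0 s'} with hG
  have hGo : IsOpen G := isOpen_setOfPred_eventually_nhds
  have hGd : ∀ s ∈ G, ∀ z ∈ U, HasDerivAt (fun τ => H τ z) 0 s := fun s hs => hs.self_of_nhds
  have hGuniv : Gᶜ = ∅ := by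
    by_contra hne
    obtain ⟨t₀, ht₀⟩ := Set.nonempty_iff_ne_empty.2 hne
    have hFc : IsClosed Gᶜ := hGo.isClosed_compl
    obtain ⟨R, hR⟩ : ∃ R, ∀ s ∈ Metric.ball t₀ 1, ∀ z ∈ U, ‖X s z‖ < R := by
      obtain ⟨M, hM⟩ := ((isCompact_closedBall t₀ 1).prod
        (isCompact_closedBall (0 : E) r)).exists_bound_of_continuousOn hXc.continuousOn
      refine ⟨M + 1, fun s hs z hz => ?_⟩
      have := hM (s, z) ⟨Metric.ball_subset_closedBall hs, Metric.ball_subset_closedBall hz⟩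
      exact this.trans_lt (lt_add_one M)
    have := hFc.completeSpace_coe
    have hdense := dense_iUnion_interior_of_closed (X := (Gᶜ : Set ℝ))
      (f := fun n : ℕ => {s | TaylorBoundOn (L s) n R})
      (fun n => (isClosed_setOf_taylorBoundOn hLtc n R).preimage continuous_subtype_val)
      (Set.eq_univ_of_forall fun s => Set.mem_iUnion.2 (exists_taylorBoundOn (hLx s) R))
    obtain ⟨t₁, ht₁, ht₁'⟩ := hdense.exists_mem_open
      (Metric.isOpen_ball.preimage continuous_subtype_val : IsOpen
        ((↑) ⁻¹' Metric.ball t₀ 1 : Set (Gᶜ : Set ℝ))) ⟨⟨t₀, ht₀⟩, Metric.mem_ball_self one_pos⟩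
    obtain ⟨n, hn⟩ := Set.mem_iUnion.1 ht₁
    have hTn : ∀ᶠ s in 𝓝[Gᶜ] (t₁ : ℝ), TaylorBoundOn (L s) n R := by
      rw [nhdsWithin_eq_map_subtype_coe t₁.2]
      exact mem_interior_iff_mem_nhds.1 hn
    refine t₁.2 ?_
    have hTn' := eventually_nhdsWithin_iff.1 hTn
    filter_upwards [hTn'.eventually_nhds, Metric.isOpen_ball.mem_nhds ht₁'] with s hs hsb z hz
    by_cases hsG : s ∈ G
    · exact hGd s hsG z hz
    have hF : HasDerivWithinAt (fun τ => H τ z) 0 Gᶜ s := by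
      have h₁ := hasDerivWithinAt_comp_of_taylorBoundOn (V := fun τ => v τ (X s z)) (F := Gᶜ)
        n.cast_nonneg (eventually_nhdsWithin_iff.2 hs) (hX s z) (hR s hsb z hz)
        (fun τ => (hLx τ).differentiable (by norm_num)) (hLt s (X s z)) (hvt _).continuousAt
        (hq _).continuousAt
      refine (h₁.add (hCd s z).hasDerivWithinAt).congr_deriv ?_
      ring
    have hnear : ∀ s', ∃ a ∈ Gᶜ, |a - s| ≤ |s' - s| ∧ H a z = H s' z := fun s' => by
      have hne' : (Gᶜ ∩ Set.uIcc s s').Nonempty := ⟨s, hsG, Set.left_mem_uIcc⟩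
      obtain ⟨a, ha, hmin⟩ := (isCompact_uIcc.inter_left hFc).exists_isMinOn hne'
        (f := fun τ => |τ - s'|) (by fun_prop)
      refine ⟨a, ha.1, Set.abs_sub_left_of_mem_uIcc ha.2, ?_⟩
      refine eq_at_endpoint_of_hasDerivAt_zero hv hX0 hX hXs hC
        (fun τ => (hLx τ).continuous) hLtc Metric.isOpen_ball (fun τ hτ hτa => ?_) hz
      refine hGd τ ?_
      by_contra hτG
      have hτs : τ ∈ Set.uIcc s s' := Set.uIcc_subset_uIcc ha.2 Set.right_mem_uIcc hτ
      have h₁ : |a - s'| ≤ |τ - s'| := hmin (show τ ∈ Gᶜ ∩ Set.uIcc s s' from ⟨hτG, hτs⟩)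
      rw [Set.mem_uIcc] at hτ
      refine hτa ?_
      rcases hτ with h | h
      · rw [abs_of_nonpos (by linarith), abs_of_nonpos (by linarith)] at h₁
        linarith
      · rw [abs_of_nonneg (by linarith), abs_of_nonneg (by linarith)] at h₁
        linarith
    rw [hasDerivWithinAt_iff_isLittleO, Asymptotics.isLittleO_iff] at hF
    rw [hasDerivAt_iff_isLittleO, Asymptotics.isLittleO_iff]
    intro ε hε
    obtain ⟨δ, hδ, hδF⟩ := Metric.mem_nhdsWithin_iff.1 (hF hε)
    filter_upwards [Metric.ball_mem_nhds s hδ] with s' hs'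
    obtain ⟨a, haF, has, haH⟩ := hnear s'
    have hab : a ∈ Metric.ball s δ := by
      rw [Metric.mem_ball, Real.dist_eq] at hs' ⊢
      exact has.trans_lt hs'
    have := hδF ⟨hab, haF⟩
    simp only [Set.mem_ofPred_eq, smul_zero, sub_zero, Real.norm_eq_abs] at this ⊢
    rw [← haH]
    exact this.trans (by gcongr)
  have hxU : x ∈ U := by simp [hUdef, hr]
  have := eq_of_hasDerivAt_zero_uIcc (h := fun τ => H τ x) (a := t) (b := 0) fun s _ =>
    hGd s (by simpa using (Set.eq_empty_iff_forall_notMem.1 hGuniv s)) x hxU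
  simpa [hH, hCdef, hX0] using this

end Transport

section Jacobian

variable {E : Type*} [NormedAddCommGroup E] [NormedSpace ℝ E]

/-- The spatial derivative of a flow solves the variational equation. -/
theorem hasDerivAt_fderiv_flow [CompleteSpace E] {v X : ℝ → E → E} {K : NNReal}
    (hv : ContDiff ℝ 1 (Function.uncurry v)) (hK : ∀ t, LipschitzWith K (v t))
    (hX0 : ∀ x, X 0 x = x) (hX : ∀ t x, HasDerivAt (fun τ => X τ x) (v t (X t x)) t)
    (hXd : ∀ t, Differentiable ℝ (X t)) (t : ℝ) (x k : E) :
    HasDerivAt (fun τ => fderiv ℝ (X τ) x k)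
      (fderiv ℝ (v t) (X t x) (fderiv ℝ (X t) x k)) t := by
  have hXt : ∀ z, Continuous fun τ => X τ z := fun z =>
    continuous_iff_continuousAt.2 fun s => (hX s z).continuousAt
  have hvd : ∀ τ, Differentiable ℝ (v τ) := fun τ =>
    (hv.comp (contDiff_prodMk_right τ)).differentiable one_ne_zero
  have hvX : ∀ z, Continuous fun τ => v τ (X τ z) := fun z =>
    hv.continuous.comp (continuous_id.prodMk (hXt z))
  have hB : Continuous fun τ => fderiv ℝ (v τ) (X τ x) :=
    Continuous.fderiv (n := 1) hv (hXt x) (by norm_num)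
  have hline : ∀ τ, HasDerivAt (fun ε : ℝ => X τ (x + ε • k)) (fderiv ℝ (X τ) x k) 0 := fun τ => by
    simpa [HasLineDerivAt] using (hXd τ x).hasFDerivAt.hasLineDerivAt k
  have hlineV : ∀ τ, HasDerivAt (fun ε : ℝ => v τ (X τ (x + ε • k)))
      (fderiv ℝ (v τ) (X τ x) (fderiv ℝ (X τ) x k)) 0 := fun τ => by
    refine HasFDerivAt.comp_hasDerivAt (x := (0 : ℝ)) (f := fun ε : ℝ => X τ (x + ε • k))
      (l := v τ) ?_ (hline τ)
    simpa using (hvd τ (X τ x)).hasFDerivAt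
  set g : ℝ → E := fun τ => fderiv ℝ (v τ) (X τ x) (fderiv ℝ (X τ) x k) with hg
  set q : ℝ → ℝ → E := fun ε τ => ε⁻¹ • (v τ (X τ (x + ε • k)) - v τ (X τ x)) with hqdef
  have hq : ∀ ε, Continuous (q ε) := fun ε => ((hvX _).sub (hvX _)).const_smul _
  have hqlim : ∀ τ, Tendsto (fun ε => q ε τ) (𝓝[≠] 0) (𝓝 (g τ)) := fun τ => by
    simpa using (hlineV τ).tendsto_slope_zero
  set β : ℝ → ℝ := fun τ => K * (‖k‖ * Real.exp (K * |τ|)) with hβ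
  have hβc : Continuous β := by fun_prop
  have hqb : ∀ ε ≠ 0, ∀ τ, ‖q ε τ‖ ≤ β τ := fun ε hε τ => by
    have h₁ := (hK τ).dist_le_mul (X τ (x + ε • k)) (X τ x)
    have h₂ := dist_le_of_hasDerivAt_trajectories hK (f := fun τ => X τ (x + ε • k))
      (g := fun τ => X τ x) (fun s => hX s _) (fun s => hX s _) 0 τ
    simp only [hX0, sub_zero, dist_eq_norm, add_sub_cancel_left, norm_smul] at h₁ h₂
    rw [hqdef, norm_smul, norm_inv, inv_mul_le_iff₀ (norm_pos_iff.2 hε)]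
    refine h₁.trans ((mul_le_mul_of_nonneg_left h₂ K.coe_nonneg).trans (le_of_eq ?_))
    simp only [hβ]
    ring
  have hgb : ∀ τ, ‖g τ‖ ≤ β τ := fun τ =>
    le_of_tendsto (hqlim τ).norm (by filter_upwards [self_mem_nhdsWithin] with ε hε using hqb ε hε τ)
  have hgi : ∀ a b, IntervalIntegrable g volume a b := fun a b => by
    refine (hβc.intervalIntegrable a b).mono_fun ?_ (Eventually.of_forall fun τ => ?_)
    · exact aestronglyMeasurable_of_tendsto_ae (𝓝[≠] (0 : ℝ))
        (fun ε => (hq ε).aestronglyMeasurable) (Eventually.of_forall hqlim)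
    · exact (hgb τ).trans (Real.le_norm_self _)
  have hXint : ∀ s z, X s z = z + ∫ τ in (0 : ℝ)..s, v τ (X τ z) := fun s z => by
    rw [intervalIntegral.integral_eq_sub_of_hasDerivAt (fun τ _ => hX τ z)
      ((hvX z).intervalIntegrable _ _), hX0]
    abel
  have hY : ∀ s, fderiv ℝ (X s) x k = k + ∫ τ in (0 : ℝ)..s, g τ := fun s => by
    have h₁ : Tendsto (fun ε : ℝ => ε⁻¹ • (X s (x + ε • k) - X s x)) (𝓝[≠] 0)
        (𝓝 (fderiv ℝ (X s) x k)) := by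
      simpa using (hline s).tendsto_slope_zero
    have h₂ : Tendsto (fun ε : ℝ => k + ∫ τ in (0 : ℝ)..s, q ε τ) (𝓝[≠] 0)
        (𝓝 (k + ∫ τ in (0 : ℝ)..s, g τ)) := by
      refine tendsto_const_nhds.add ?_
      refine intervalIntegral.tendsto_integral_filter_of_dominated_convergence β
        (Eventually.of_forall fun ε => (hq ε).aestronglyMeasurable) ?_
        (hβc.intervalIntegrable _ _) (Eventually.of_forall fun τ _ => hqlim τ)
      filter_upwards [self_mem_nhdsWithin] with ε hε
      exact Eventually.of_forall fun τ _ => hqb ε hε τ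
    refine tendsto_nhds_unique (h₁.congr' ?_) h₂
    filter_upwards [self_mem_nhdsWithin] with ε hε
    have hε' : ε ≠ 0 := hε
    rw [hXint s (x + ε • k), hXint s x, hqdef, intervalIntegral.integral_smul,
      intervalIntegral.integral_sub ((hvX _).intervalIntegrable _ _)
        ((hvX _).intervalIntegrable _ _)]
    rw [show x + ε • k + (∫ τ in (0 : ℝ)..s, v τ (X τ (x + ε • k))) -
        (x + ∫ τ in (0 : ℝ)..s, v τ (X τ x)) = ε • k + ((∫ τ in (0 : ℝ)..s, v τ (X τ (x + ε • k)))
          - ∫ τ in (0 : ℝ)..s, v τ (X τ x)) by abel, smul_add, smul_smul, inv_mul_cancel₀ hε',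
      one_smul]
  have hYc : Continuous fun s => fderiv ℝ (X s) x k := by
    simp only [hY]
    exact continuous_const.add (intervalIntegral.continuous_primitive hgi 0)
  have hgc : Continuous g := hB.clm_apply hYc
  have := (intervalIntegral.integral_hasDerivAt_right (hgi 0 t)
    (hgc.stronglyMeasurableAtFilter _ _) hgc.continuousAt).const_add k
  exact this.congr_of_eventuallyEq (Eventually.of_forall hY)

/-- Jacobi's formula along a solution of the linear system `M' = A M`. -/
theorem hasDerivAt_det_of_hasDerivAt_mul {n : Type*} [Fintype n] [DecidableEq n]
    {M : ℝ → Matrix n n ℝ} {A : Matrix n n ℝ} {t : ℝ}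
    (hM : ∀ i j, HasDerivAt (fun s => M s i j) ((A * M t) i j) t) :
    HasDerivAt (fun s => (M s).det) (A.trace * (M t).det) t := by
  let D : (n → n → ℝ) → ℝ := fun B => (Matrix.of B).det
  have hD : Differentiable ℝ D := by
    simp only [D, Matrix.det_apply, Matrix.of_apply]
    fun_prop
  have chain : ∀ {N : ℝ → n → n → ℝ} {s : ℝ}, N s = M t →
      (∀ i j, HasDerivAt (fun u => N u i j) ((A * M t) i j) s) →
      HasDerivAt (fun u => D (N u)) (fderiv ℝ D (M t) (A * M t)) s := fun {N s} hs hN => by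
    have hN' : HasDerivAt N (A * M t) s :=
      hasDerivAt_pi.2 fun i => hasDerivAt_pi.2 fun j => hN i j
    have h := HasFDerivAt.comp_hasDerivAt s (hD (N s)).hasFDerivAt hN'
    rwa [hs] at h
  have hline : HasDerivAt (fun u : ℝ => D ((1 + u • A) * M t : Matrix n n ℝ)) (fderiv ℝ D (M t) (A * M t)) 0 := by
    refine chain (N := fun u : ℝ => ((1 + u • A) * M t : Matrix n n ℝ)) (by simp; rfl) fun i j => ?_
    simp only [add_mul, one_mul, Matrix.smul_mul, Matrix.add_apply, Matrix.smul_apply, smul_eq_mul]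
    simpa using ((hasDerivAt_id (0 : ℝ)).mul_const ((A * M t) i j)).const_add (M t i j)
  have hval : HasDerivAt (fun u : ℝ => D ((1 + u • A) * M t : Matrix n n ℝ)) (A.trace * (M t).det) 0 := by
    have e : (fun u : ℝ => D ((1 + u • A) * M t : Matrix n n ℝ)) = fun u =>
        (1 + A.trace * u +
          (Matrix.det (1 + (Polynomial.X : Polynomial ℝ) • A.map Polynomial.C)).divX.divX.eval u
            * u ^ 2) * (M t).det := by
      funext u
      change ((1 + u • A) * M t).det = _
      rw [Matrix.det_mul, Matrix.det_one_add_smul]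
    rw [e]
    have hp : HasDerivAt (fun u : ℝ =>
        (Matrix.det (1 + (Polynomial.X : Polynomial ℝ) • A.map Polynomial.C)).divX.divX.eval u
          * u ^ 2) 0 0 := by
      simpa using (Polynomial.hasDerivAt (Matrix.det
        (1 + (Polynomial.X : Polynomial ℝ) • A.map Polynomial.C)).divX.divX 0).fun_mul
          (hasDerivAt_pow 2 (0 : ℝ))
    simpa using ((((hasDerivAt_id (0 : ℝ)).const_mul A.trace).const_add 1).fun_add hp).mul_const
      (M t).det
  rw [hval.unique hline]
  exact chain rfl hM

theorem dvg_eq_trace {d : ℕ} (F : (Fin d → ℝ) → (Fin d → ℝ)) (x : Fin d → ℝ) :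
    dvg F x = (LinearMap.toMatrix' (fderiv ℝ F x : (Fin d → ℝ) →ₗ[ℝ] (Fin d → ℝ))).trace := by
  simp [dvg, Matrix.trace, LinearMap.toMatrix'_apply]

theorem dvg_smul {d : ℕ} {f : (Fin d → ℝ) → ℝ} {F : (Fin d → ℝ) → (Fin d → ℝ)} {x : Fin d → ℝ}
    (hf : DifferentiableAt ℝ f x) (hF : DifferentiableAt ℝ F x) :
    dvg (fun y => f y • F y) x = fderiv ℝ f x (F x) + f x * dvg F x := by
  have hsum : fderiv ℝ f x (F x) = ∑ i, fderiv ℝ f x (Pi.single i 1) * F x i := by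
    conv_lhs => rw [← Finset.univ_sum_single (F x)]
    rw [map_sum]
    refine Finset.sum_congr rfl fun i _ => ?_
    rw [← mul_one (F x i), ← smul_eq_mul, Pi.single_smul, map_smul]
    simp [mul_comm]
  rw [hsum, dvg, dvg, Finset.mul_sum, ← Finset.sum_add_distrib]
  refine Finset.sum_congr rfl fun i _ => ?_
  rw [fderiv_fun_smul hf hF]
  simp [add_comm]

/-- Liouville's formula for the Jacobian determinant of a flow. -/
theorem det_fderiv_flow_eq_exp {d : ℕ} {v X : ℝ → (Fin d → ℝ) → (Fin d → ℝ)} {K : NNReal}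
    (hv : ContDiff ℝ 1 (Function.uncurry v)) (hK : ∀ t, LipschitzWith K (v t))
    (hX0 : ∀ x, X 0 x = x) (hX : ∀ t x, HasDerivAt (fun τ => X τ x) (v t (X t x)) t)
    (hXd : ∀ t, Differentiable ℝ (X t)) (hc : Continuous (Function.uncurry fun t => dvg (v t)))
    (t : ℝ) (x : Fin d → ℝ) :
    (fderiv ℝ (X t) x).det = Real.exp (∫ τ in (0 : ℝ)..t, dvg (v τ) (X τ x)) := by
  have hXt : Continuous fun τ => X τ x :=
    continuous_iff_continuousAt.2 fun s => (hX s x).continuousAt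
  have hcX : Continuous fun τ => dvg (v τ) (X τ x) := hc.comp (continuous_id.prodMk hXt)
  set M : ℝ → Matrix (Fin d) (Fin d) ℝ := fun s =>
    LinearMap.toMatrix' (fderiv ℝ (X s) x : (Fin d → ℝ) →ₗ[ℝ] (Fin d → ℝ)) with hM
  have hdet : ∀ s, (fderiv ℝ (X s) x).det = (M s).det := fun s => by
    rw [hM, LinearMap.det_toMatrix']
  have hMd : ∀ s, HasDerivAt (fun u => (M u).det) (dvg (v s) (X s x) * (M s).det) s := fun s => by
    rw [dvg_eq_trace]
    refine hasDerivAt_det_of_hasDerivAt_mul fun i j => ?_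
    have := hasDerivAt_pi.1 (hasDerivAt_fderiv_flow hv hK hX0 hX hXd s x (Pi.single j 1)) i
    rw [hM, ← LinearMap.toMatrix'_comp]
    simpa [LinearMap.toMatrix'_apply] using this
  have hI : ∀ s, HasDerivAt (fun u => ∫ τ in (0 : ℝ)..u, dvg (v τ) (X τ x))
      (dvg (v s) (X s x)) s := fun s =>
    intervalIntegral.integral_hasDerivAt_right (hcX.intervalIntegrable _ _)
      (hcX.stronglyMeasurableAtFilter _ _) hcX.continuousAt
  have hconst := eq_of_hasDerivAt_zero_uIcc (a := t) (b := 0)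
    (h := fun s => (M s).det * Real.exp (-∫ τ in (0 : ℝ)..s, dvg (v τ) (X τ x))) fun s _ => by
      refine ((hMd s).mul (hI s).fun_neg.exp).congr_deriv ?_
      ring
  have hX0' : X 0 = id := funext hX0
  have h0 : (M 0).det = 1 := by
    rw [← hdet, hX0', fderiv_id]
    exact LinearMap.det_id
  simp only [intervalIntegral.integral_same, neg_zero, Real.exp_zero, mul_one, h0] at hconst
  rw [hdet, ← mul_one (Real.exp _), ← hconst, mul_left_comm, ← Real.exp_add]
  simp

end Jacobian

theorem stmt_9 (d : ℕ) (hd : 1 ≤ d)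
    (v : ℝ → (Fin d → ℝ) → (Fin d → ℝ))
    (ρ : ℝ → (Fin d → ℝ) → ℝ)
    (X : ℝ → (Fin d → ℝ) → (Fin d → ℝ))
    -- `v` is C² in `t` and `x` jointly and globally Lipschitz in `x`
    (hv : ContDiff ℝ 2 (Function.uncurry v))
    (hvlip : ∃ K : NNReal, ∀ t, LipschitzWith K (v t))
    -- `ρ` is everywhere positive, C¹ in `t`, C² in `x`, with `ρ 0` a probability density
    (hρpos : ∀ t x, 0 < ρ t x)
    (hρ0prob : (∫ x, ρ 0 x) = 1)
    (hρt : ∀ x, ContDiff ℝ 1 (fun t => ρ t x))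
    (hρx : ∀ t, ContDiff ℝ 2 (ρ t))
    -- transport equation
    (hTE : ∀ t x, deriv (fun τ => ρ τ x) t = - dvg (fun y => ρ t y • v t y) x)
    -- the flow of `v`
    (hX0 : ∀ x, X 0 x = x)
    (hXflow : ∀ t x, HasDerivAt (fun τ => X τ x) (v t (X t x)) t)
    -- `X t` is a C¹ diffeomorphism
    (hXbij : ∀ t, Function.Bijective (X t))
    (hXC1 : ∀ t, ContDiff ℝ 1 (X t))
    (hXinvC1 : ∀ t, ContDiff ℝ 1 (Function.invFun (X t))) :
    ∀ (φ : (Fin d → ℝ) → ℝ), Continuous φ → (∃ M, ∀ x, |φ x| ≤ M) →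
      ∀ t : ℝ, 0 ≤ t →
        (∫ y, φ y * ρ t y) = ∫ x, φ (X t x) * ρ 0 x := by
  obtain ⟨K, hK⟩ := hvlip
  intro φ _ _ t _
  have hvd : ∀ t, Differentiable ℝ (v t) := fun t =>
    (hv.comp (contDiff_prodMk_right t)).differentiable two_ne_zero
  have hvt : ∀ y, Continuous fun t => v t y := fun y =>
    hv.continuous.comp (Continuous.prodMk_left y)
  have hv1 : ContDiff ℝ 1 (Function.uncurry v) := hv.of_le (by norm_num)
  have hc : Continuous (Function.uncurry fun t => dvg (v t)) := by
    have : Continuous fun p : ℝ × (Fin d → ℝ) => fderiv ℝ (v p.1) p.2 := by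
      refine Continuous.fderiv (n := 1) (f := fun p : ℝ × (Fin d → ℝ) => v p.1) ?_ continuous_snd
        (by norm_num)
      exact hv1.comp ((contDiff_fst.comp contDiff_fst).prodMk contDiff_snd)
    unfold Function.uncurry dvg
    fun_prop
  have hρd : ∀ t, Differentiable ℝ (ρ t) := fun t => (hρx t).differentiable two_ne_zero
  set L : ℝ → (Fin d → ℝ) → ℝ := fun t y => Real.log (ρ t y) with hL
  have hLx : ∀ t, ContDiff ℝ 2 (L t) := fun t => (hρx t).log fun y => (hρpos t y).ne'
  have hLf : ∀ t y w, fderiv ℝ (L t) y w = (ρ t y)⁻¹ * fderiv ℝ (ρ t) y w := fun t y w => by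
    rw [((hρd t y).hasFDerivAt.log (hρpos t y).ne').fderiv]
    simp
  have hρt' : ∀ t y, HasDerivAt (fun τ => ρ τ y)
      (-(fderiv ℝ (ρ t) y (v t y) + ρ t y * dvg (v t) y)) t := fun t y => by
    rw [← dvg_smul (hρd t y) (hvd t y), ← hTE]
    exact ((hρt y).differentiable one_ne_zero t).hasDerivAt
  have hLt : ∀ t y, HasDerivAt (fun τ => L τ y)
      (-(fderiv ℝ (L t) y (v t y) + dvg (v t) y)) t := fun t y => by
    refine ((hρt' t y).log (hρpos t y).ne').congr_deriv ?_
    have := (hρpos t y).ne'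
    rw [hLf]
    field_simp
  have hq : ∀ y, Continuous fun t => fderiv ℝ (L t) y (v t y) := fun y => by
    have hdc : Continuous fun t => deriv (fun τ => ρ τ y) t := (hρt y).continuous_deriv le_rfl
    have hρc : Continuous fun t => ρ t y := (hρt y).continuous
    have hcy : Continuous fun t => dvg (v t) y := hc.comp (Continuous.prodMk_left y)
    have : (fun t => fderiv ℝ (L t) y (v t y)) = fun t =>
        -((ρ t y)⁻¹ * deriv (fun τ => ρ τ y) t) - dvg (v t) y := by
      funext s
      have := (hρpos s y).ne'
      rw [hLf, (hρt' s y).deriv]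
      field_simp
      ring
    rw [this]
    exact ((hρc.inv₀ fun s => (hρpos s y).ne').mul hdc).neg.sub hcy
  have hXd : ∀ t, Differentiable ℝ (X t) := fun t => (hXC1 t).differentiable one_ne_zero
  have hchar : ∀ x, |(fderiv ℝ (X t) x).det| * ρ t (X t x) = ρ 0 x := fun x => by
    have := add_integral_along_flow_eq hK hvt hX0 hXflow (fun t => (hXbij t).2) hc hLx hLt hq t x
    rw [det_fderiv_flow_eq_exp hv1 hK hX0 hXflow hXd hc, Real.abs_exp,
      ← Real.exp_log (hρpos t (X t x)), ← Real.exp_add, ← Real.exp_log (hρpos 0 x), add_comm]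
    exact congrArg Real.exp this
  have hcov := integral_image_eq_integral_abs_det_fderiv_smul volume MeasurableSet.univ
    (fun x _ => (hXd t x).hasFDerivAt.hasFDerivWithinAt) (hXbij t).1.injOn
    (fun y => φ y * ρ t y)
  rw [Set.image_univ, (hXbij t).2.range_eq, setIntegral_univ, setIntegral_univ] at hcov
  rw [hcov]
  refine integral_congr_ae (Eventually.of_forall fun x => ?_)
  simp only [smul_eq_mul, ← hchar x]
  ring
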